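/- Let A_n be a sequence of n×n real matrices with Tr(A_n A_nᵀ) = n and such that Σ_{i≠j} A_{ii} A_{jj} / n² → c for some constant 0 ≤ c ≤ 1. Let M be an n×n Haar-distributed orthogonal matrix and C_n the permutation matrix of the n-cycle (1,...,n). Then Tr(A_n M C_n Mᵀ) converges in distribution to a centered normal with variance 1 − c as n → ∞. -/

import Mathlib

open MeasureTheory Matrix

/-- Matrices are measurable as functions to functions (pi measurable structure). -/
instance matrixMeasurableSpace (n : ℕ) : MeasurableSpace (Matrix (Fin n) (Fin n) ℝ) :=
  inferInstanceAs (MeasurableSpace ((Fin n) → (Fin n) → ℝ))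

/-- `μ` is the Haar probability measure on the orthogonal group `O(n)`, viewed as a
measure on `n × n` real matrices: it is a probability measure concentrated on
orthogonal matrices which is invariant under left and right translation by
orthogonal matrices. -/
structure IsHaarOrthogonal (n : ℕ) (μ : Measure (Matrix (Fin n) (Fin n) ℝ)) : Prop where
  isProb : IsProbabilityMeasure μ
  ae_orth : ∀ᵐ M ∂μ, M * Mᵀ = 1
  left_inv : ∀ V : Matrix (Fin n) (Fin n) ℝ, V * Vᵀ = 1 → μ.map (fun M => V * M) = μ
  right_inv : ∀ V : Matrix (Fin n) (Fin n) ℝ, V * Vᵀ = 1 → μ.map (fun M => M * V) = μ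

open ProbabilityTheory BoundedContinuousFunction


namespace HaarCLT

abbrev Mat (n : ℕ) := Matrix (Fin n) (Fin n) ℝ

instance matBorel (n : ℕ) : BorelSpace (Mat n) :=
  inferInstanceAs (BorelSpace (Fin n → Fin n → ℝ))

/-- directional derivative along the right-invariant vector field `X`. -/
def Dv {n : ℕ} (X : Mat n) (F F' : Mat n → ℝ) : Prop :=
  ∀ M, HasDerivAt (fun s : ℝ => F (NormedSpace.exp (s • X) * M)) (F' M) 0

def DvM {n : ℕ} (X : Mat n) (P P' : Mat n → Mat n) : Prop :=
  ∀ i j, Dv X (fun M => P M i j) (fun M => P' M i j)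

section
attribute [local instance] Matrix.linftyOpNormedRing Matrix.linftyOpNormedAlgebra

lemma hasDerivAt_exp_entry {n : ℕ} (X : Mat n) (i j : Fin n) :
    HasDerivAt (fun s : ℝ => NormedSpace.exp (s • X) i j) (X i j) 0 := by
  have h := hasDerivAt_exp_smul_const (𝕂 := ℝ) X (0 : ℝ)
  simp only [zero_smul, NormedSpace.exp_zero, one_mul] at h
  have h2 := (Matrix.entryLinearMap ℝ ℝ i j : Mat n →ₗ[ℝ] ℝ).toContinuousLinearMap.hasFDerivAt.comp_hasDerivAt (0:ℝ) h
  exact h2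
end

lemma exp_orth {n : ℕ} (X : Mat n) (hX : Xᵀ = -X) (s : ℝ) :
    NormedSpace.exp (s • X) * (NormedSpace.exp (s • X))ᵀ = 1 := by
  rw [← Matrix.exp_transpose, transpose_smul, hX, smul_neg, Matrix.exp_neg]
  exact Matrix.mul_nonsing_inv _ ((Matrix.isUnit_iff_isUnit_det _).1 (Matrix.isUnit_exp _))

lemma exp_add' {n : ℕ} (X : Mat n) (s t : ℝ) :
    NormedSpace.exp ((s + t) • X) = NormedSpace.exp (s • X) * NormedSpace.exp (t • X) := by
  rw [add_smul, Matrix.exp_add_of_commute]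
  exact ((Commute.refl X).smul_left s).smul_right t

lemma Dv_const {n : ℕ} (X : Mat n) (a : ℝ) : Dv X (fun _ => a) (fun _ => 0) := by
  intro M; exact hasDerivAt_const _ _

lemma Dv.mul {n : ℕ} {X : Mat n} {F F' G G' : Mat n → ℝ} (h : Dv X F F') (k : Dv X G G') :
    Dv X (fun M => F M * G M) (fun M => F' M * G M + F M * G' M) := by
  intro M
  have := (h M).fun_mul (k M)
  simpa using this

lemma Dv.sum {n : ℕ} {ι : Type*} {s : Finset ι} {X : Mat n} {F F' : ι → Mat n → ℝ}
    (h : ∀ i ∈ s, Dv X (F i) (F' i)) :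
    Dv X (fun M => ∑ i ∈ s, F i M) (fun M => ∑ i ∈ s, F' i M) := by
  intro M
  exact HasDerivAt.fun_sum fun i hi => h i hi M

lemma Dv.comp {n : ℕ} {X : Mat n} {F F' : Mat n → ℝ} (h : Dv X F F') {u u' : ℝ → ℝ}
    (hu : ∀ x, HasDerivAt u (u' x) x) :
    Dv X (fun M => u (F M)) (fun M => u' (F M) * F' M) := by
  intro M
  have h1 := h M
  have := (hu (F (NormedSpace.exp ((0:ℝ) • X) * M))).comp (0:ℝ) h1
  simpa [Function.comp_def] using this

lemma DvM_id {n : ℕ} (X : Mat n) : DvM X (fun M => M) (fun M => X * M) := by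
  intro i j M
  simp only [Matrix.mul_apply]
  exact HasDerivAt.fun_sum fun k _ => (hasDerivAt_exp_entry X i k).mul_const _

lemma DvM_const {n : ℕ} (X : Mat n) (A : Mat n) : DvM X (fun _ => A) (fun _ => 0) := by
  intro i j; exact Dv_const X _

lemma DvM.transpose {n : ℕ} {X : Mat n} {P P' : Mat n → Mat n} (h : DvM X P P') :
    DvM X (fun M => (P M)ᵀ) (fun M => (P' M)ᵀ) := fun i j => h j i

lemma DvM.mul {n : ℕ} {X : Mat n} {P P' Q Q' : Mat n → Mat n} (h : DvM X P P')
    (k : DvM X Q Q') : DvM X (fun M => P M * Q M) (fun M => P' M * Q M + P M * Q' M) := by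
  intro i j
  simp only [Matrix.mul_apply, Matrix.add_apply, ← Finset.sum_add_distrib]
  exact Dv.sum fun l _ => (h i l).mul (k l j)

lemma DvM.trace {n : ℕ} {X : Mat n} {P P' : Mat n → Mat n} (h : DvM X P P') :
    Dv X (fun M => (P M).trace) (fun M => (P' M).trace) := by
  simp only [Matrix.trace, Matrix.diag]
  exact Dv.sum fun i _ => h i i

/-- conjugate -/
def cj {n : ℕ} (C M : Mat n) : Mat n := M * C * Mᵀ

lemma DvM_cj {n : ℕ} (X : Mat n) (hX : Xᵀ = -X) (C : Mat n) :
    DvM X (cj C) (fun M => X * cj C M - cj C M * X) := by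
  have h := ((DvM_id X).mul (DvM_const X C)).mul (DvM_id X).transpose
  have e : (fun M => X * cj C M - cj C M * X) =
      (fun M => (X * M * C + M * 0) * Mᵀ + (M * C) * (X * M)ᵀ) := by
    funext M
    simp only [cj, Matrix.transpose_mul, hX]
    simp [Matrix.mul_assoc, sub_eq_add_neg]
  rw [e]; exact h

lemma isCompact_orth (n : ℕ) : IsCompact {M : Mat n | M * Mᵀ = 1} := by
  have hc : IsCompact (Set.pi Set.univ fun _ : Fin n => Set.pi Set.univ
      fun _ : Fin n => Set.Icc (-1:ℝ) 1) :=
    isCompact_univ_pi fun _ => isCompact_univ_pi fun _ => isCompact_Icc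
  refine IsCompact.of_isClosed_subset (X := Mat n) hc ?_ ?_
  · exact isClosed_eq (by fun_prop) continuous_const
  · intro M hM i _ j _
    have hM' : M * Mᵀ = 1 := hM
    have h : ∑ k, M i k * M i k = 1 := by
      have := congrFun (congrFun hM' i) i
      simpa [Matrix.mul_apply] using this
    have h2 : M i j * M i j ≤ 1 := by
      rw [← h]
      exact Finset.single_le_sum (f := fun k => M i k * M i k)
        (fun k _ => mul_self_nonneg _) (Finset.mem_univ j)
    constructor <;> nlinarith

lemma orth_bound {n : ℕ} {F : Mat n → ℝ} (hF : Continuous F) :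
    ∃ K, ∀ M : Mat n, M * Mᵀ = 1 → ‖F M‖ ≤ K := by
  obtain ⟨K, hK⟩ := (isCompact_orth n).exists_bound_of_continuousOn hF.continuousOn
  exact ⟨K, fun M hM => hK M hM⟩

lemma integrable_cont {n : ℕ} {μ : Measure (Mat n)} (hμ : IsHaarOrthogonal n μ)
    {F : Mat n → ℝ} (hF : Continuous F) : Integrable F μ := by
  have := hμ.isProb
  obtain ⟨K, hK⟩ := orth_bound hF
  refine Integrable.of_bound hF.measurable.aestronglyMeasurable K ?_
  filter_upwards [hμ.ae_orth] with M hM using hK M hM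

lemma ibp {n : ℕ} {μ : Measure (Mat n)} (hμ : IsHaarOrthogonal n μ) {X : Mat n}
    (hX : Xᵀ = -X) {F F' : Mat n → ℝ} (hF : Continuous F) (hF' : Continuous F')
    (h : Dv X F F') : ∫ M, F' M ∂μ = 0 := by
  have := hμ.isProb
  obtain ⟨K, hK⟩ := orth_bound hF'
  have key := hasDerivAt_integral_of_dominated_loc_of_deriv_le (μ := μ) (𝕜 := ℝ)
    (F := fun s M => F (NormedSpace.exp (s • X) * M))
    (F' := fun s M => F' (NormedSpace.exp (s • X) * M)) (x₀ := 0) (s := Set.univ)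
    (bound := fun _ => K) Filter.univ_mem
    (Filter.Eventually.of_forall fun s => (hF.comp (by fun_prop :
      Continuous fun M : Mat n => NormedSpace.exp (s • X) * M)).measurable.aestronglyMeasurable)
    (by simpa using integrable_cont hμ hF)
    (by simpa using hF'.measurable.aestronglyMeasurable)
    (by
      filter_upwards [hμ.ae_orth] with M hM s _
      apply hK
      rw [Matrix.transpose_mul, Matrix.mul_assoc, ← Matrix.mul_assoc M, hM, Matrix.one_mul]
      exact exp_orth X hX s)
    (integrable_const _)
    (by
      refine Filter.Eventually.of_forall fun M s _ => ?_
      have h1 := h (NormedSpace.exp (s • X) * M)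
      have h2 : HasDerivAt (fun t : ℝ => t - s) 1 s := (hasDerivAt_id s).sub_const s
      have h1' : HasDerivAt (fun s' : ℝ => F (NormedSpace.exp (s' • X) *
        (NormedSpace.exp (s • X) * M))) (F' (NormedSpace.exp (s • X) * M)) (s - s) := by
        simpa using h1
      have h3 := HasDerivAt.comp (h := fun t : ℝ => t - s) s h1' h2
      simp only [mul_one] at h3
      refine h3.congr_of_eventuallyEq (Filter.Eventually.of_forall fun t => ?_)
      simp only [Function.comp]
      rw [← Matrix.mul_assoc, ← exp_add', sub_add_cancel])
  have hconst : ∀ s : ℝ, ∫ M, F (NormedSpace.exp (s • X) * M) ∂μ = ∫ M, F M ∂μ := by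
    intro s
    have hc : Continuous fun M : Mat n => NormedSpace.exp (s • X) * M := by fun_prop
    conv_rhs => rw [← hμ.left_inv _ (exp_orth X hX s)]
    rw [integral_map hc.measurable.aemeasurable hF.measurable.aestronglyMeasurable]
  have k2 := key.2
  simp only [hconst] at k2
  have := k2.unique (hasDerivAt_const _ _)
  simpa using this

/-- elementary skew matrix -/
def Sk {n : ℕ} (i j : Fin n) : Mat n := Matrix.single i j 1 - Matrix.single j i 1

lemma Sk_transpose {n : ℕ} (i j : Fin n) : (Sk i j : Mat n)ᵀ = - Sk i j := by
  simp [Sk]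

lemma sum_Sk {n : ℕ} (P Q : Mat n) :
    ∑ i : Fin n, ∑ j : Fin n, (P * Sk i j * Q) i j = P.trace * Q.trace - (P * Qᵀ).trace := by
  have h : ∀ i j : Fin n, (P * Sk i j * Q) i j = P i i * Q j j - P i j * Q i j := by
    intro i j
    have aux : ∀ a b, (P * Matrix.single a b (1:ℝ) * Q) i j = P i a * Q b j := by
      intro a b
      simp [Matrix.mul_apply, Matrix.single_apply, ite_and]
    simp only [Sk, Matrix.mul_sub, Matrix.sub_mul, Matrix.sub_apply, aux]
  simp only [h, Finset.sum_sub_distrib, Matrix.trace, Matrix.diag, Matrix.mul_apply,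
    Matrix.transpose_apply, Finset.sum_mul_sum]

lemma sum_Sk_trace {n : ℕ} (Y P : Mat n) :
    ∑ i : Fin n, ∑ j : Fin n, (Sk i j * Y).trace * P i j = (Y * P).trace - (Y * Pᵀ).trace := by
  have h : ∀ i j : Fin n, (Sk i j * Y).trace = Y j i - Y i j := by
    intro i j
    have aux : ∀ a b, (Matrix.single a b (1:ℝ) * Y).trace = Y b a := by
      intro a b
      simp [Matrix.trace, Matrix.mul_apply, Matrix.single_apply, ite_and]
    simp only [Sk, Matrix.sub_mul, Matrix.trace_sub, aux]
  simp only [h, sub_mul, Finset.sum_sub_distrib]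
  simp only [Matrix.trace, Matrix.diag, Matrix.mul_apply,
    Matrix.transpose_apply]
  congr 1
  exact Finset.sum_comm

lemma loop {n : ℕ} {μ : Measure (Mat n)} (hμ : IsHaarOrthogonal n μ)
    {ψ : Mat n → ℝ} {Y : Mat n → Mat n} (hψ : Continuous ψ) (hY : Continuous Y)
    (dψ : ∀ X : Mat n, Xᵀ = -X → Dv X ψ (fun M => (X * Y M).trace))
    {P : Mat n → Mat n} {P' : Mat n → Mat n → Mat n} (hP : Continuous P)
    (hP' : ∀ X, Continuous (P' X)) (dP : ∀ X : Mat n, Xᵀ = -X → DvM X P (P' X)) :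
    ∫ M, (ψ M * (∑ i : Fin n, ∑ j : Fin n, P' (Sk i j) M i j)
      + ((Y M * P M).trace - (Y M * (P M)ᵀ).trace)) ∂μ = 0 := by
  have hc : ∀ i j : Fin n, Continuous fun M => P M i j := fun i j => by fun_prop
  have hc' : ∀ X (i j : Fin n), Continuous fun M => P' X M i j := fun X i j =>
    (hP' X).matrix_elem i j
  have h1 : ∀ i j : Fin n, ∫ M, ((Sk i j * Y M).trace * P M i j + ψ M * P' (Sk i j) M i j) ∂μ = 0 := by
    intro i j
    refine ibp hμ (Sk_transpose i j) (F := fun M => ψ M * P M i j) (hψ.mul (hc i j)) ?_ ?_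
    · exact (((continuous_const.mul hY).matrix_trace).mul (hc i j)).add (hψ.mul (hc' _ i j))
    · exact (dψ _ (Sk_transpose i j)).mul (dP _ (Sk_transpose i j) i j)
  have hintg : ∀ i j : Fin n, Integrable (fun M => (Sk i j * Y M).trace * P M i j
      + ψ M * P' (Sk i j) M i j) μ := fun i j => integrable_cont hμ
    ((((continuous_const.mul hY).matrix_trace).mul (hc i j)).add (hψ.mul (hc' _ i j)))
  have h2 : ∫ M, (∑ i : Fin n, ∑ j : Fin n, ((Sk i j * Y M).trace * P M i j + ψ M * P' (Sk i j) M i j)) ∂μ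
      = 0 := by
    rw [integral_finsetSum _ fun i _ => integrable_finsetSum _ fun j _ => hintg i j]
    refine Finset.sum_eq_zero fun i _ => ?_
    rw [integral_finsetSum _ fun j _ => hintg i j]
    exact Finset.sum_eq_zero fun j _ => h1 i j
  rw [← h2]
  congr 1
  funext M
  simp only [Finset.sum_add_distrib, sum_Sk_trace, Finset.mul_sum]
  ring

lemma continuous_cj {n : ℕ} (C : Mat n) : Continuous (cj C) := by
  unfold cj; fun_prop

lemma loop_f {n : ℕ} {μ : Measure (Mat n)} (hμ : IsHaarOrthogonal n μ)
    {ψ : Mat n → ℝ} {Y : Mat n → Mat n} (hψ : Continuous ψ) (hY : Continuous Y)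
    (dψ : ∀ X : Mat n, Xᵀ = -X → Dv X ψ (fun M => (X * Y M).trace)) (C A : Mat n) :
    ∫ M, (ψ M * ((n - 1 : ℝ) * (cj C M * A).trace - (cj C M).trace * A.trace
        + (cj Cᵀ M * A).trace)
      + ((Y M * (cj C M * A)).trace - (Y M * (cj C M * A)ᵀ).trace)) ∂μ = 0 := by
  have hc := continuous_cj C
  have h := loop hμ hψ hY dψ (P := fun M => cj C M * A)
    (P' := fun X M => (X * cj C M - cj C M * X) * A + cj C M * 0) (by fun_prop)
    (fun X => by fun_prop) (fun X hX => (DvM_cj X hX C).mul (DvM_const X A))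
  rw [← h]
  congr 1
  funext M
  have e : ∑ i : Fin n, ∑ j : Fin n, ((Sk i j * cj C M - cj C M * Sk i j) * A + cj C M * 0) i j
      = (n - 1 : ℝ) * (cj C M * A).trace - (cj C M).trace * A.trace
        + (cj Cᵀ M * A).trace := by
    have h1 := sum_Sk (1 : Mat n) (cj C M * A)
    have h2 := sum_Sk (cj C M) A
    have e1 : ∀ i j : Fin n, ((Sk i j * cj C M - cj C M * Sk i j) * A + cj C M * 0) i j =
      ((1 : Mat n) * Sk i j * (cj C M * A)) i j - (cj C M * Sk i j * A) i j := by
      intro i j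
      simp [Matrix.sub_mul, Matrix.mul_assoc]
    simp only [e1, Finset.sum_sub_distrib, h1, h2]
    have e2 : (cj C M * Aᵀ).trace = (cj Cᵀ M * A).trace := by
      rw [← Matrix.trace_transpose, Matrix.transpose_mul, Matrix.transpose_transpose,
        Matrix.trace_mul_comm]
      simp [cj, Matrix.mul_assoc]
    rw [e2]
    simp only [Matrix.trace_one, Matrix.one_mul, Matrix.trace_transpose, Fintype.card_fin]
    ring
  rw [e]

lemma loop_h {n : ℕ} {μ : Measure (Mat n)} (hμ : IsHaarOrthogonal n μ)
    {ψ : Mat n → ℝ} {Y : Mat n → Mat n} (hψ : Continuous ψ) (hY : Continuous Y)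
    (dψ : ∀ X : Mat n, Xᵀ = -X → Dv X ψ (fun M => (X * Y M).trace)) (C A C' A' : Mat n) :
    ∫ M, (ψ M * ((n - 1 : ℝ) * (cj C M * A * (cj C' M * A')).trace
        - (cj C M).trace * (A * (cj C' M * A')).trace
        + (cj C M * (A * (cj C' M * A'))ᵀ).trace
        + (cj C M * A).trace * (cj C' M * A').trace
        - (cj C M * A * (cj C' M * A')ᵀ).trace
        - (cj C M * A * cj C' M).trace * A'.trace
        + (cj C M * A * cj C' M * A'ᵀ).trace)
      + ((Y M * (cj C M * A * (cj C' M * A'))).trace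
        - (Y M * (cj C M * A * (cj C' M * A'))ᵀ).trace)) ∂μ = 0 := by
  have hc := continuous_cj C
  have hc' := continuous_cj C'
  have h := loop hμ hψ hY dψ (P := fun M => cj C M * A * (cj C' M * A'))
    (P' := fun X M => ((X * cj C M - cj C M * X) * A + cj C M * 0) * (cj C' M * A') +
      (cj C M * A) * ((X * cj C' M - cj C' M * X) * A' + cj C' M * 0)) (by fun_prop)
    (fun X => by fun_prop) (fun X hX => ((DvM_cj X hX C).mul (DvM_const X A)).mul
      ((DvM_cj X hX C').mul (DvM_const X A')))
  rw [← h]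
  congr 1
  funext M
  have e1 : ∀ i j : Fin n, (((Sk i j * cj C M - cj C M * Sk i j) * A + cj C M * 0) * (cj C' M * A') +
      (cj C M * A) * ((Sk i j * cj C' M - cj C' M * Sk i j) * A' + cj C' M * 0)) i j =
      ((1 : Mat n) * Sk i j * (cj C M * A * (cj C' M * A'))) i j
      - (cj C M * Sk i j * (A * (cj C' M * A'))) i j
      + (cj C M * A * Sk i j * (cj C' M * A')) i j
      - (cj C M * A * cj C' M * Sk i j * A') i j := by
    intro i j
    simp only [Matrix.sub_mul, Matrix.mul_sub, Matrix.mul_assoc, Matrix.mul_zero, add_zero,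
      Matrix.add_apply, Matrix.sub_apply, Matrix.one_mul]
    ring
  simp only [e1, Finset.sum_sub_distrib, Finset.sum_add_distrib, sum_Sk]
  simp only [Matrix.trace_one, Matrix.one_mul, Matrix.trace_transpose, Fintype.card_fin]
  ring

lemma dψ_f {n : ℕ} (C A : Mat n) {u u' : ℝ → ℝ} (hu : ∀ x, HasDerivAt u (u' x) x)
    (X : Mat n) (hX : Xᵀ = -X) :
    Dv X (fun M => u (cj C M * A).trace) (fun M =>
      (X * (u' (cj C M * A).trace • (cj C M * A - A * cj C M))).trace) := by
  have h := (((DvM_cj X hX C).mul (DvM_const X A)).trace).comp hu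
  convert h using 2 with M
  rw [Matrix.mul_smul, Matrix.trace_smul, smul_eq_mul]
  congr 1
  simp only [Matrix.mul_sub, Matrix.sub_mul, Matrix.trace_sub, Matrix.mul_zero, add_zero]
  rw [← Matrix.mul_assoc, ← Matrix.mul_assoc, Matrix.trace_mul_comm (X * A), Matrix.mul_assoc,
    Matrix.mul_assoc]

lemma dψ_h {n : ℕ} (C A C' A' : Mat n) (X : Mat n) (hX : Xᵀ = -X) :
    Dv X (fun M => (cj C M * A * (cj C' M * A')).trace) (fun M =>
      (X * ((cj C M * A * (cj C' M * A') - A * (cj C' M * A') * cj C M)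
        + (cj C' M * A' * (cj C M * A) - A' * (cj C M * A) * cj C' M))).trace) := by
  have h := (((DvM_cj X hX C).mul (DvM_const X A)).mul
    ((DvM_cj X hX C').mul (DvM_const X A'))).trace
  convert h using 2 with M
  simp only [Matrix.mul_sub, Matrix.sub_mul, Matrix.trace_sub, Matrix.mul_zero, add_zero,
    Matrix.mul_add, Matrix.trace_add]
  have r1 : (X * (A * (cj C' M * A') * cj C M)).trace =
      (cj C M * X * A * (cj C' M * A')).trace := by
    rw [← Matrix.mul_assoc, Matrix.trace_mul_comm]; simp only [Matrix.mul_assoc]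
  have r2 : (X * (A' * (cj C M * A) * cj C' M)).trace =
      (cj C M * A * (cj C' M * X * A')).trace := by
    rw [← Matrix.mul_assoc, Matrix.trace_mul_comm, Matrix.trace_mul_comm (cj C M * A)]
    simp only [Matrix.mul_assoc]
  have r3 : (X * (cj C' M * A' * (cj C M * A))).trace =
      (cj C M * A * (X * cj C' M * A')).trace := by
    rw [Matrix.trace_mul_comm (cj C M * A)]
    simp only [Matrix.mul_assoc]
  rw [r1, r2, r3]
  simp only [Matrix.mul_assoc]

/-- Frobenius norm -/
noncomputable def nF {n : ℕ} (A : Mat n) : ℝ := Real.sqrt (A * Aᵀ).trace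

lemma trace_mul_transpose_eq {n : ℕ} (A B : Mat n) :
    (A * Bᵀ).trace = ∑ i, ∑ j, A i j * B i j := by
  simp [Matrix.trace, Matrix.mul_apply]

lemma trace_self_nonneg {n : ℕ} (A : Mat n) : 0 ≤ (A * Aᵀ).trace := by
  rw [trace_mul_transpose_eq]
  exact Finset.sum_nonneg fun i _ => Finset.sum_nonneg fun j _ => mul_self_nonneg _

lemma nF_nonneg {n : ℕ} (A : Mat n) : 0 ≤ nF A := Real.sqrt_nonneg _

lemma nF_sq {n : ℕ} (A : Mat n) : nF A ^ 2 = (A * Aᵀ).trace :=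
  Real.sq_sqrt (trace_self_nonneg A)

section
attribute [local instance] Matrix.frobeniusNormedRing

lemma nF_eq_norm {n : ℕ} (A : Mat n) : nF A = ‖A‖ := by
  rw [Matrix.frobenius_norm_def, nF, trace_mul_transpose_eq, Real.sqrt_eq_rpow]
  simp [pow_two]

lemma nF_mul {n : ℕ} (A B : Mat n) : nF (A * B) ≤ nF A * nF B := by
  simp only [nF_eq_norm]; exact norm_mul_le _ _

lemma nF_add {n : ℕ} (A B : Mat n) : nF (A + B) ≤ nF A + nF B := by
  simp only [nF_eq_norm]; exact norm_add_le _ _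

lemma nF_sub {n : ℕ} (A B : Mat n) : nF (A - B) ≤ nF A + nF B := by
  simp only [nF_eq_norm]; exact norm_sub_le _ _
end

lemma nF_transpose {n : ℕ} (A : Mat n) : nF Aᵀ = nF A := by
  rw [nF, nF, Matrix.transpose_transpose, Matrix.trace_mul_comm]

lemma tr_mul_transpose_le {n : ℕ} (A B : Mat n) : |(A * Bᵀ).trace| ≤ nF A * nF B := by
  rw [nF, nF, ← Real.sqrt_mul (trace_self_nonneg A)]
  apply Real.abs_le_sqrt
  simp only [trace_mul_transpose_eq, ← Finset.sum_product', ← pow_two]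
  exact Finset.sum_mul_sq_le_sq_mul_sq _ _ _

lemma tr_mul_le {n : ℕ} (A B : Mat n) : |(A * B).trace| ≤ nF A * nF B := by
  have := tr_mul_transpose_le A Bᵀ
  rwa [Matrix.transpose_transpose, nF_transpose] at this

lemma nF_orth_mul {n : ℕ} {O : Mat n} (hO : O * Oᵀ = 1) (A : Mat n) : nF (O * A) = nF A := by
  have h' : Oᵀ * O = 1 := mul_eq_one_comm.1 hO
  rw [nF, nF, Matrix.transpose_mul, ← Matrix.mul_assoc, Matrix.trace_mul_comm,
    ← Matrix.mul_assoc, ← Matrix.mul_assoc, h', Matrix.one_mul]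

lemma nF_mul_orth {n : ℕ} {O : Mat n} (hO : O * Oᵀ = 1) (A : Mat n) : nF (A * O) = nF A := by
  rw [nF, nF, Matrix.transpose_mul, Matrix.mul_assoc, ← Matrix.mul_assoc O, hO, Matrix.one_mul]

lemma cj_orth {n : ℕ} {C M : Mat n} (hC : C * Cᵀ = 1) (hM : M * Mᵀ = 1) :
    cj C M * (cj C M)ᵀ = 1 := by
  have h' : Mᵀ * M = 1 := mul_eq_one_comm.1 hM
  have : cj C M * (cj C M)ᵀ = M * (C * ((Mᵀ * M) * (Cᵀ * Mᵀ))) := by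
    simp [cj, Matrix.mul_assoc]
  rw [this, h', Matrix.one_mul, ← Matrix.mul_assoc C, hC, Matrix.one_mul, hM]

lemma cj_trace {n : ℕ} {C M : Mat n} (hM : M * Mᵀ = 1) : (cj C M).trace = C.trace := by
  have h' : Mᵀ * M = 1 := mul_eq_one_comm.1 hM
  rw [cj, Matrix.trace_mul_comm, ← Matrix.mul_assoc, h', Matrix.one_mul]

lemma cj_transpose {n : ℕ} (C M : Mat n) : (cj C M)ᵀ = cj Cᵀ M := by
  simp [cj, Matrix.mul_assoc]

lemma cj_mul {n : ℕ} {C D M : Mat n} (hM : M * Mᵀ = 1) : cj C M * cj D M = cj (C * D) M := by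
  have h' : Mᵀ * M = 1 := mul_eq_one_comm.1 hM
  have : cj C M * cj D M = M * (C * ((Mᵀ * M) * (D * Mᵀ))) := by simp [cj, Matrix.mul_assoc]
  rw [this, h', Matrix.one_mul]; simp [cj, Matrix.mul_assoc]

lemma half_moment {n : ℕ} {μ : Measure (Mat n)} (hμ : IsHaarOrthogonal n μ)
    (C A : Mat n) (hC : C * Cᵀ = 1) (ht : C.trace = 0) :
    ∫ M, ((cj C M * A).trace * ((n - 1 : ℝ) * (cj C M * A).trace + (cj Cᵀ M * A).trace)) ∂μ
      ≤ 4 * nF A ^ 2 := by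
  have := hμ.isProb
  have hc := continuous_cj C
  have hc' := continuous_cj Cᵀ
  have h := loop_f hμ (ψ := fun M => (cj C M * A).trace)
    (Y := fun M => (1:ℝ) • (cj C M * A - A * cj C M)) (by fun_prop) (by fun_prop)
    (fun X hX => dψ_f C A (u := fun x => x) (u' := fun _ => 1) (fun x => hasDerivAt_id x) X hX) C A
  set G : Mat n → ℝ := _ with hG
  have h' : ∫ M, G M ∂μ = 0 := h
  have hGi : Integrable G μ := integrable_cont hμ (by rw [hG]; fun_prop)
  have : ∫ M, ((cj C M * A).trace * ((n - 1 : ℝ) * (cj C M * A).trace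
      + (cj Cᵀ M * A).trace)) ∂μ ≤ ∫ M, (G M + 4 * nF A ^ 2) ∂μ := by
    refine integral_mono_ae (integrable_cont hμ (by fun_prop)) (hGi.add (integrable_const _)) ?_
    filter_upwards [hμ.ae_orth] with M hM
    have o := cj_orth hC hM
    have e1 : nF (cj C M * A) = nF A := nF_orth_mul o A
    have e2 : nF (cj C M * A - A * cj C M) ≤ 2 * nF A := by
      refine (nF_sub _ _).trans ?_
      rw [e1, nF_mul_orth o]; linarith
    have b1 := tr_mul_le (cj C M * A - A * cj C M) (cj C M * A)
    have b2 := tr_mul_transpose_le (cj C M * A - A * cj C M) (cj C M * A)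
    rw [e1] at b1 b2
    have b3 : nF (cj C M * A - A * cj C M) * nF A ≤ 2 * nF A * nF A :=
      mul_le_mul_of_nonneg_right e2 (nF_nonneg _)
    simp only [hG, one_smul, cj_trace hM, ht]
    have := (abs_le.1 b1).1
    have := (abs_le.1 b2).2
    nlinarith
  rw [integral_add hGi (integrable_const _), h'] at this
  simpa using this

lemma second_moment {n : ℕ} (hn : 3 ≤ n) {μ : Measure (Mat n)} (hμ : IsHaarOrthogonal n μ)
    (C A : Mat n) (hC : C * Cᵀ = 1) (ht : C.trace = 0) :
    (n - 2 : ℝ) * ∫ M, (cj C M * A).trace ^ 2 ∂μ ≤ 8 * nF A ^ 2 := by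
  have h1 := half_moment hμ C A hC ht
  have h2 := half_moment hμ Cᵀ A (by rw [Matrix.transpose_transpose]; exact mul_eq_one_comm.1 hC)
    (by rw [Matrix.trace_transpose, ht])
  rw [Matrix.transpose_transpose] at h2
  have hc := continuous_cj C
  have hc' := continuous_cj Cᵀ
  have hn' : (3:ℝ) ≤ n := by exact_mod_cast hn
  have h3 : ∫ M, (n - 2 : ℝ) * (cj C M * A).trace ^ 2 ∂μ ≤
      ∫ M, ((cj C M * A).trace * ((n - 1 : ℝ) * (cj C M * A).trace + (cj Cᵀ M * A).trace)
      + (cj Cᵀ M * A).trace * ((n - 1 : ℝ) * (cj Cᵀ M * A).trace + (cj C M * A).trace)) ∂μ := by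
    refine integral_mono (integrable_cont hμ (by fun_prop)) (integrable_cont hμ (by fun_prop)) ?_
    intro M
    simp only
    nlinarith [sq_nonneg ((cj C M * A).trace + (cj Cᵀ M * A).trace),
      mul_nonneg (by linarith : (0:ℝ) ≤ n - 2) (sq_nonneg (cj Cᵀ M * A).trace)]
  rw [integral_add (integrable_cont hμ (by fun_prop)) (integrable_cont hμ (by fun_prop)),
    integral_const_mul] at h3
  linarith

lemma scalar_bound (n x r1 r2 r3 f f' y1 y2 : ℝ) (hn : 0 ≤ n) (t1 : |x| ≤ n) (t2 : |r1| ≤ n)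
    (t3 : |r2| ≤ n) (t4 : |r3| ≤ n) (t5 : -(4 * n * n) ≤ y1) (t6 : y2 ≤ 4 * n * n) :
    (n - 1) * x ^ 2 ≤ x * ((n - 1) * x + r1 + f * f' - r2 + r3) + (y1 - y2)
      + (n / 2 * f ^ 2 + (n / 2 * f' ^ 2 + 11 * n ^ 2)) := by
  have R : ∀ r : ℝ, |r| ≤ n → |x * r| ≤ n * n := fun r hr => by
    rw [abs_mul]; exact mul_le_mul t1 hr (abs_nonneg _) hn
  have R1 := (abs_le.1 (R r1 t2)).1
  have R2 := (abs_le.1 (R r2 t3)).2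
  have R3 := (abs_le.1 (R r3 t4)).1
  have q1 : |x * (f * f')| ≤ n * |f * f'| := by
    rw [abs_mul]; exact mul_le_mul_of_nonneg_right t1 (abs_nonneg _)
  have q2 : |f * f'| ≤ (f ^ 2 + f' ^ 2) / 2 := by
    rw [abs_le]
    constructor
    · linarith [sq_nonneg (f + f')]
    · linarith [sq_nonneg (f - f')]
  have q3 : n * |f * f'| ≤ n * ((f ^ 2 + f' ^ 2) / 2) := mul_le_mul_of_nonneg_left q2 hn
  have q4 := (abs_le.1 q1).1
  linarith

lemma h_moment {n : ℕ} (hn : 3 ≤ n) {μ : Measure (Mat n)} (hμ : IsHaarOrthogonal n μ)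
    (C A C' A' : Mat n) (hC : C * Cᵀ = 1) (ht : C.trace = 0)
    (hC' : C' * C'ᵀ = 1) (ht' : C'.trace = 0) (hA : nF A ^ 2 ≤ n) (hA' : nF A' ^ 2 ≤ n)
    (tA' : A'.trace = 0) :
    (n - 1 : ℝ) * ∫ M, (cj C M * A * (cj C' M * A')).trace ^ 2 ∂μ ≤ 19 * n ^ 2 := by
  have := hμ.isProb
  have hn' : (3:ℝ) ≤ n := by exact_mod_cast hn
  have hc := continuous_cj C
  have hc' := continuous_cj C'
  have h := loop_h hμ (ψ := fun M => (cj C M * A * (cj C' M * A')).trace)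
    (Y := fun M => ((cj C M * A * (cj C' M * A') - A * (cj C' M * A') * cj C M)
        + (cj C' M * A' * (cj C M * A) - A' * (cj C M * A) * cj C' M)))
    (by fun_prop) (by fun_prop) (fun X hX => dψ_h C A C' A' X hX) C A C' A'
  set G : Mat n → ℝ := _ with hG
  have h' : ∫ M, G M ∂μ = 0 := h
  have hGi : Integrable G μ := integrable_cont hμ (by rw [hG]; fun_prop)
  have aa : nF A * nF A' ≤ n := by nlinarith [sq_nonneg (nF A - nF A')]
  have aa0 : 0 ≤ nF A * nF A' := mul_nonneg (nF_nonneg _) (nF_nonneg _)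
  have m1 := second_moment hn hμ C A hC ht
  have m2 := second_moment hn hμ C' A' hC' ht'
  have m1' : ∫ M, (cj C M * A).trace ^ 2 ∂μ ≤ 8 * n := by
    have p : 0 ≤ ∫ M, (cj C M * A).trace ^ 2 ∂μ := integral_nonneg fun M => sq_nonneg _
    nlinarith
  have m2' : ∫ M, (cj C' M * A').trace ^ 2 ∂μ ≤ 8 * n := by
    have p : 0 ≤ ∫ M, (cj C' M * A').trace ^ 2 ∂μ := integral_nonneg fun M => sq_nonneg _
    nlinarith
  have : ∫ M, (n - 1 : ℝ) * (cj C M * A * (cj C' M * A')).trace ^ 2 ∂μ ≤ ∫ M, (G M +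
      (n / 2 * (cj C M * A).trace ^ 2 + (n / 2 * (cj C' M * A').trace ^ 2
        + 11 * (n:ℝ) ^ 2))) ∂μ := by
    refine integral_mono_ae (integrable_cont hμ (by fun_prop))
      (hGi.add (integrable_cont hμ (by fun_prop))) ?_
    filter_upwards [hμ.ae_orth] with M hM
    have o := cj_orth hC hM
    have o' := cj_orth hC' hM
    simp only [hG, cj_trace hM, ht, tA']
    generalize cj C M = B at *
    generalize cj C' M = B' at *
    have n1 : nF (B * A) = nF A := nF_orth_mul o A
    have n2 : nF (B' * A') = nF A' := nF_orth_mul o' A'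
    have n3 : nF (B * A * (B' * A')) ≤ n := by
      refine (nF_mul _ _).trans ?_; rw [n1, n2]; exact aa
    have n4 : nF (A * (B' * A') * B) ≤ n := by
      rw [nF_mul_orth o]; refine (nF_mul _ _).trans ?_; rw [n2]; exact aa
    have n5 : nF (B' * A' * (B * A)) ≤ n := by
      refine (nF_mul _ _).trans ?_; rw [n1, n2, mul_comm]; exact aa
    have n6 : nF (A' * (B * A) * B') ≤ n := by
      rw [nF_mul_orth o']; refine (nF_mul _ _).trans ?_; rw [n1, mul_comm]; exact aa
    have nY : nF ((B * A * (B' * A') - A * (B' * A') * B)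
        + (B' * A' * (B * A) - A' * (B * A) * B')) ≤ 4 * n := by
      refine (nF_add _ _).trans ?_
      linarith [nF_sub (B * A * (B' * A')) (A * (B' * A') * B),
        nF_sub (B' * A' * (B * A)) (A' * (B * A) * B')]
    have t1 : |(B * A * (B' * A')).trace| ≤ n := by
      refine (tr_mul_le _ _).trans ?_; rw [n1, n2]; exact aa
    have t2 : |(B * (A * (B' * A'))ᵀ).trace| ≤ n := by
      rw [← Matrix.trace_transpose, Matrix.transpose_mul, Matrix.transpose_transpose,
        Matrix.mul_assoc]
      refine (tr_mul_le _ _).trans ?_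
      rw [nF_mul_orth (by rw [Matrix.transpose_transpose]; exact mul_eq_one_comm.1 o), n2]
      exact aa
    have t3 : |(B * A * (B' * A')ᵀ).trace| ≤ n := by
      refine (tr_mul_transpose_le _ _).trans ?_; rw [n1, n2]; exact aa
    have t4 : |(B * A * B' * A'ᵀ).trace| ≤ n := by
      refine (tr_mul_transpose_le _ _).trans ?_; rw [nF_mul_orth o', n1]; exact aa
    have t5 := tr_mul_le ((B * A * (B' * A') - A * (B' * A') * B)
        + (B' * A' * (B * A) - A' * (B * A) * B')) (B * A * (B' * A'))
    have t6 := tr_mul_transpose_le ((B * A * (B' * A') - A * (B' * A') * B)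
        + (B' * A' * (B * A) - A' * (B * A) * B')) (B * A * (B' * A'))
    have t7 := mul_le_mul nY n3 (nF_nonneg _) (by positivity)
    have t5' := (abs_le.1 (t5.trans t7)).1
    have t6' := (abs_le.1 (t6.trans t7)).2
    generalize (((B * A * (B' * A') - A * (B' * A') * B)
        + (B' * A' * (B * A) - A' * (B * A) * B')) * (B * A * (B' * A'))).trace = y1 at *
    generalize (((B * A * (B' * A') - A * (B' * A') * B)
        + (B' * A' * (B * A) - A' * (B * A) * B')) * (B * A * (B' * A'))ᵀ).trace = y2 at *
    generalize (B * A * (B' * A')).trace = x at *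
    generalize (B * (A * (B' * A'))ᵀ).trace = r1 at *
    generalize (B * A * (B' * A')ᵀ).trace = r2 at *
    generalize (B * A * B' * A'ᵀ).trace = r3 at *
    generalize (B * A).trace = f at *
    generalize (B' * A').trace = f' at *
    have := scalar_bound (n : ℝ) x r1 r2 r3 f f' y1 y2 (by positivity) t1 t2 t3 t4 t5' t6'
    simp only [zero_mul, mul_zero, sub_zero]
    linarith
  rw [integral_add hGi (integrable_cont hμ (by fun_prop)), h',
    integral_add (integrable_cont hμ (by fun_prop)) (integrable_cont hμ (by fun_prop)),
    integral_add (integrable_cont hμ (by fun_prop)) (integrable_const _),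
    integral_const_mul, integral_const_mul, integral_const_mul] at this
  simp only [integral_const, probReal_univ, one_smul] at this
  nlinarith

lemma l1_of_l2 {n : ℕ} {μ : Measure (Mat n)} (hμ : IsHaarOrthogonal n μ) {F : Mat n → ℝ}
    (hF : Continuous F) {K : ℝ} (hK : 0 ≤ K) (h : ∫ M, F M ^ 2 ∂μ ≤ K ^ 2) :
    ∫ M, |F M| ∂μ ≤ K := by
  have := hμ.isProb
  set m := ∫ M, |F M| ∂μ with hm
  have h1 : 0 ≤ ∫ M, (F M ^ 2 - (2 * m * |F M| - m ^ 2)) ∂μ := by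
    refine integral_nonneg fun M => ?_
    have := sq_nonneg (|F M| - m)
    have e : |F M| ^ 2 = F M ^ 2 := sq_abs _
    simp only [Pi.zero_apply]
    nlinarith
  rw [integral_sub (integrable_cont hμ (by fun_prop)) (integrable_cont hμ (by fun_prop)),
    integral_sub (integrable_cont hμ (by fun_prop)) (integrable_const _),
    integral_const_mul] at h1
  simp only [integral_const, probReal_univ, one_smul] at h1
  rw [← hm] at h1
  have : m ^ 2 ≤ K ^ 2 := by nlinarith
  exact le_of_sq_le_sq this hK

set_option maxHeartbeats 2000000 in
lemma stein {n : ℕ} (hn : 3 ≤ n) {μ : Measure (Mat n)} (hμ : IsHaarOrthogonal n μ)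
    (C A : Mat n) (hC : C * Cᵀ = 1) (ht : C.trace = 0) (ht2 : (C * C).trace = 0)
    (hA : nF A ^ 2 ≤ n) (tA : A.trace = 0) {u u' : ℝ → ℝ} (hu : ∀ x, HasDerivAt u (u' x) x)
    (cu' : Continuous u') {T : ℝ} (bu : ∀ x, |u x| ≤ 1) (bu' : ∀ x, |u' x| ≤ T) :
    |∫ M, (cj C M * A).trace * u (cj C M * A).trace ∂μ
      - nF A ^ 2 / n * ∫ M, u' (cj C M * A).trace ∂μ| ≤ 17 / Real.sqrt n * (1 + T) := by
  have := hμ.isProb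
  have hn' : (3:ℝ) ≤ n := by exact_mod_cast hn
  have hT : 0 ≤ T := (abs_nonneg _).trans (bu' 0)
  have hc := continuous_cj C
  have hct := continuous_cj Cᵀ
  have hcc := continuous_cj (C * C)
  have cu : Continuous u := continuous_iff_continuousAt.2 fun x => (hu x).continuousAt
  have hCt : Cᵀ * Cᵀᵀ = 1 := by rw [Matrix.transpose_transpose]; exact mul_eq_one_comm.1 hC
  have htt : Cᵀ.trace = 0 := by rw [Matrix.trace_transpose, ht]
  have hCC : (C * C) * (C * C)ᵀ = 1 := by
    rw [Matrix.transpose_mul, Matrix.mul_assoc, ← Matrix.mul_assoc C Cᵀ, hC, Matrix.one_mul, hC]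
  set s := Real.sqrt n with hs
  have s2 : s ^ 2 = n := Real.sq_sqrt (by positivity)
  have s0 : 0 < s := Real.sqrt_pos.2 (by linarith)
  have s1 : 1 ≤ s := by nlinarith
  -- moments
  have Ef : ∫ M, |(cj C M * A).trace| ∂μ ≤ 5 := by
    refine l1_of_l2 hμ (by fun_prop) (by norm_num) ?_
    have := second_moment hn hμ C A hC ht
    nlinarith
  have Ef' : ∫ M, |(cj Cᵀ M * A).trace| ∂μ ≤ 5 := by
    refine l1_of_l2 hμ (by fun_prop) (by norm_num) ?_
    have := second_moment hn hμ Cᵀ A hCt htt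
    nlinarith
  have Eq : ∫ M, |(cj (C * C) M * (A * A)).trace| ∂μ ≤ 5 * s := by
    refine l1_of_l2 hμ (by fun_prop) (by positivity) ?_
    have h1 := second_moment hn hμ (C * C) (A * A) hCC ht2
    have h2 : nF (A * A) ^ 2 ≤ (n:ℝ) ^ 2 := by
      have := nF_mul A A
      have h0 := nF_nonneg (A * A)
      have : nF (A * A) ≤ n := by nlinarith
      nlinarith
    rw [mul_pow, s2]
    nlinarith
  have Eh1 : ∫ M, |(cj C M * Aᵀ * (cj Cᵀ M * A)).trace| ∂μ ≤ 6 * s := by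
    refine l1_of_l2 hμ (by fun_prop) (by positivity) ?_
    have h1 := h_moment hn hμ C Aᵀ Cᵀ A hC ht hCt htt (by rw [nF_transpose]; exact hA) hA tA
    rw [mul_pow, s2]
    nlinarith
  have Eh2 : ∫ M, |(cj C M * A * (cj C M * A)).trace| ∂μ ≤ 6 * s := by
    refine l1_of_l2 hμ (by fun_prop) (by positivity) ?_
    have h1 := h_moment hn hμ C A C A hC ht hC ht hA hA tA
    rw [mul_pow, s2]
    nlinarith
  have h := loop_f hμ (ψ := fun M => u (cj C M * A).trace)
    (Y := fun M => u' (cj C M * A).trace • (cj C M * A - A * cj C M)) (by fun_prop) (by fun_prop)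
    (fun X hX => dψ_f C A hu X hX) C A
  set G : Mat n → ℝ := _ with hG
  have h' : ∫ M, G M ∂μ = 0 := h
  have hGc : Continuous G := by rw [hG]; fun_prop
  have key : ‖∫ M, ((n * ((cj C M * A).trace * u (cj C M * A).trace)
      - nF A ^ 2 * u' (cj C M * A).trace) - G M) ∂μ‖ ≤ ∫ M, ((|(cj C M * A).trace|
        + |(cj Cᵀ M * A).trace|) + T * (|(cj C M * Aᵀ * (cj Cᵀ M * A)).trace|
        + |(cj C M * A * (cj C M * A)).trace| + |(cj (C * C) M * (A * A)).trace|)) ∂μ := by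
    refine norm_integral_le_of_norm_le (integrable_cont hμ (by fun_prop)) ?_
    filter_upwards [hμ.ae_orth] with M hM
    have o := cj_orth hC hM
    simp only [hG, cj_trace hM, ht, tA, Matrix.smul_mul, Matrix.trace_smul, smul_eq_mul]
    rw [← cj_mul hM, ← cj_transpose]
    generalize cj C M = B at *
    have e1 : ((B * A - A * B) * (B * A)).trace = (B * A * (B * A)).trace
        - (B * B * (A * A)).trace := by
      rw [Matrix.sub_mul, Matrix.trace_sub]
      congr 1
      rw [Matrix.mul_assoc, Matrix.trace_mul_comm]
      simp only [Matrix.mul_assoc]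
    have e2 : ((B * A - A * B) * (B * A)ᵀ).trace = nF A ^ 2 - (B * Aᵀ * (Bᵀ * A)).trace := by
      rw [Matrix.sub_mul, Matrix.trace_sub, ← nF_sq, nF_orth_mul o]
      congr 1
      rw [Matrix.mul_assoc, Matrix.trace_mul_comm, Matrix.transpose_mul]
      simp only [Matrix.mul_assoc]
    rw [e1, e2]
    have b := bu (B * A).trace
    have b' := bu' (B * A).trace
    generalize u (B * A).trace = w at *
    generalize u' (B * A).trace = w' at *
    generalize (B * A * (B * A)).trace = h2
    generalize (B * B * (A * A)).trace = q
    generalize (B * Aᵀ * (Bᵀ * A)).trace = h1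
    generalize (B * A).trace = f
    generalize (Bᵀ * A).trace = f'
    have e3 : (n * (f * w) - nF A ^ 2 * w') - (w * ((n - 1 : ℝ) * f - 0 * 0 + f')
        + (w' * (h2 - q) - w' * (nF A ^ 2 - h1))) = w * f - w * f' - w' * (h1 + h2 - q) := by
      ring
    rw [e3, Real.norm_eq_abs]
    have a1 : |w * f| ≤ |f| := by
      rw [abs_mul]; exact mul_le_of_le_one_left (abs_nonneg _) b
    have a2 : |w * f'| ≤ |f'| := by
      rw [abs_mul]; exact mul_le_of_le_one_left (abs_nonneg _) b
    have a3 : |w' * (h1 + h2 - q)| ≤ T * (|h1| + |h2| + |q|) := by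
      rw [abs_mul]
      refine mul_le_mul b' ?_ (abs_nonneg _) hT
      exact (abs_sub _ _).trans (add_le_add_left (abs_add_le _ _) _)
    calc |w * f - w * f' - w' * (h1 + h2 - q)|
        ≤ |w * f| + |w * f'| + |w' * (h1 + h2 - q)| :=
          (abs_sub _ _).trans (add_le_add_left (abs_sub _ _) _)
      _ ≤ _ := by linarith
  rw [integral_sub (integrable_cont hμ (by fun_prop)) (integrable_cont hμ hGc), h', sub_zero,
    integral_sub (integrable_cont hμ (by fun_prop)) (integrable_cont hμ (by fun_prop)),
    integral_const_mul, integral_const_mul,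
    integral_add (integrable_cont hμ (by fun_prop)) (integrable_cont hμ (by fun_prop)),
    integral_add (integrable_cont hμ (by fun_prop)) (integrable_cont hμ (by fun_prop)),
    integral_const_mul,
    integral_add (integrable_cont hμ (by fun_prop)) (integrable_cont hμ (by fun_prop)),
    integral_add (integrable_cont hμ (by fun_prop)) (integrable_cont hμ (by fun_prop))] at key
  set I1 := ∫ M, (cj C M * A).trace * u (cj C M * A).trace ∂μ
  set I2 := ∫ M, u' (cj C M * A).trace ∂μ
  have e4 : I1 - nF A ^ 2 / n * I2 = (n * I1 - nF A ^ 2 * I2) / n := by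
    field_simp
  rw [e4, abs_div, abs_of_pos (by linarith : (0:ℝ) < n), div_le_iff₀ (by linarith)]
  rw [Real.norm_eq_abs] at key
  refine key.trans ?_
  have e5 : 17 / s * (1 + T) * n = 17 * s * (1 + T) := by
    rw [← s2]; field_simp
  rw [e5]
  have : T * (∫ M, |(cj C M * Aᵀ * (cj Cᵀ M * A)).trace| ∂μ
      + ∫ M, |(cj C M * A * (cj C M * A)).trace| ∂μ
      + ∫ M, |(cj (C * C) M * (A * A)).trace| ∂μ) ≤ T * (17 * s) :=
    mul_le_mul_of_nonneg_left (by linarith) hT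
  linarith

lemma ode {a a' : ℝ → ℝ} (ha : ∀ t, HasDerivAt a (a' t) t) {v δ : ℝ} (hv : 0 ≤ v) (hδ : 0 ≤ δ)
    (h : ∀ t, |a' t + v * t * a t| ≤ δ * (1 + |t|)) (t : ℝ) :
    |a t - a 0 * Real.exp (-(v * t ^ 2 / 2))| ≤ δ * (1 + |t|) * |t| := by
  have hd : ∀ s, HasDerivAt (fun s => Real.exp (v * s ^ 2 / 2) * a s)
      (Real.exp (v * s ^ 2 / 2) * (a' s + v * s * a s)) s := by
    intro s
    have h1 : HasDerivAt (fun s : ℝ => v * s ^ 2 / 2) (v * s) s := by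
      have h0 : HasDerivAt (fun s : ℝ => s ^ 2) (2 * s) s := by simpa using hasDerivAt_pow 2 s
      exact ((h0.const_mul v).div_const 2).congr_deriv (by ring)
    exact (h1.exp.fun_mul (ha s)).congr_deriv (by ring)
  have hb := Convex.norm_image_sub_le_of_norm_hasDerivWithin_le (s := Set.Icc (-|t|) |t|)
    (C := Real.exp (v * t ^ 2 / 2) * (δ * (1 + |t|))) (x := 0) (y := t)
    (fun s _ => (hd s).hasDerivWithinAt) (by
      intro s hs
      have hs' : |s| ≤ |t| := abs_le.2 hs
      have hs2 : s ^ 2 ≤ t ^ 2 := sq_le_sq.2 hs'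
      rw [norm_mul, Real.norm_eq_abs, Real.norm_eq_abs, abs_of_pos (Real.exp_pos _)]
      refine mul_le_mul ?_ ?_ (abs_nonneg _) (Real.exp_pos _).le
      · exact Real.exp_le_exp.2 (by nlinarith)
      · exact (h s).trans (mul_le_mul_of_nonneg_left (by linarith) hδ))
    (convex_Icc _ _) (by simp) (abs_le.1 le_rfl)
  simp only [Real.norm_eq_abs, sub_zero] at hb
  have e : a t - a 0 * Real.exp (-(v * t ^ 2 / 2)) = Real.exp (-(v * t ^ 2 / 2)) *
      (Real.exp (v * t ^ 2 / 2) * a t - Real.exp (v * 0 ^ 2 / 2) * a 0) := by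
    rw [mul_sub, ← mul_assoc, ← Real.exp_add]
    simp; ring
  rw [e, abs_mul, abs_of_pos (Real.exp_pos _)]
  calc _ ≤ Real.exp (-(v * t ^ 2 / 2)) *
        (Real.exp (v * t ^ 2 / 2) * (δ * (1 + |t|)) * |t|) :=
        mul_le_mul_of_nonneg_left hb (Real.exp_pos _).le
    _ = _ := by
      rw [mul_assoc (Real.exp _), ← mul_assoc, ← Real.exp_add]
      simp

lemma hasDerivAt_integral_trig {n : ℕ} {μ : Measure (Mat n)} (hμ : IsHaarOrthogonal n μ)
    {F : Mat n → ℝ} (hF : Continuous F) {u u' : ℝ → ℝ} (hu : ∀ x, HasDerivAt u (u' x) x)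
    (cu' : Continuous u') (bu' : ∀ x, |u' x| ≤ 1) (t : ℝ) :
    HasDerivAt (fun t => ∫ M, u (t * F M) ∂μ) (∫ M, F M * u' (t * F M) ∂μ) t := by
  have cu : Continuous u := continuous_iff_continuousAt.2 fun x => (hu x).continuousAt
  refine (hasDerivAt_integral_of_dominated_loc_of_deriv_le (μ := μ) (𝕜 := ℝ)
    (F := fun t M => u (t * F M)) (F' := fun t M => F M * u' (t * F M)) (x₀ := t) (s := Set.univ)
    (bound := fun M => |F M|) Filter.univ_mem
    (Filter.Eventually.of_forall fun s => (by fun_prop :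
      Continuous fun M => u (s * F M)).measurable.aestronglyMeasurable)
    (integrable_cont hμ (by fun_prop))
    ((by fun_prop : Continuous fun M => F M * u' (t * F M)).measurable.aestronglyMeasurable)
    ?_ (integrable_cont hμ (by fun_prop)) ?_).2
  · refine Filter.Eventually.of_forall fun M s _ => ?_
    rw [norm_mul, Real.norm_eq_abs]
    exact mul_le_of_le_one_right (abs_nonneg _) (bu' _)
  · refine Filter.Eventually.of_forall fun M s _ => ?_
    have h1 : HasDerivAt (fun s : ℝ => s * F M) (F M) s := by
      simpa using (hasDerivAt_id s).mul_const (F M)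
    have := (hu (s * F M)).comp s h1
    rw [mul_comm]
    exact this

lemma char_bounds {n : ℕ} (hn : 3 ≤ n) {μ : Measure (Mat n)} (hμ : IsHaarOrthogonal n μ)
    (C A : Mat n) (hC : C * Cᵀ = 1) (ht : C.trace = 0) (ht2 : (C * C).trace = 0)
    (hA : nF A ^ 2 ≤ n) (tA : A.trace = 0) (t : ℝ) :
    |∫ M, Real.cos (t * (cj C M * A).trace) ∂μ - Real.exp (-(nF A ^ 2 / n * t ^ 2 / 2))|
      ≤ 17 / Real.sqrt n * (1 + |t|) * |t| ∧
    |∫ M, Real.sin (t * (cj C M * A).trace) ∂μ| ≤ 17 / Real.sqrt n * (1 + |t|) * |t| := by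
  have := hμ.isProb
  have hc := continuous_cj C
  have hF : Continuous fun M => (cj C M * A).trace := by fun_prop
  have lin : ∀ s x : ℝ, HasDerivAt (fun x => s * x) s x := fun s x => by
    simpa using (hasDerivAt_id x).const_mul s
  constructor
  · have := ode (a := fun t => ∫ M, Real.cos (t * (cj C M * A).trace) ∂μ)
      (fun t => hasDerivAt_integral_trig hμ hF (u := Real.cos) (u' := fun x => -Real.sin x)
        Real.hasDerivAt_cos (by fun_prop) (fun x => by
          rw [abs_neg]; exact Real.abs_sin_le_one x) t)
      (v := nF A ^ 2 / n) (δ := 17 / Real.sqrt n) (by positivity) (by positivity) ?_ t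
    · simpa using this
    · intro s
      have h1 := stein hn hμ C A hC ht ht2 hA tA (u := fun x => Real.sin (s * x))
        (u' := fun x => Real.cos (s * x) * s) (T := |s|)
        (fun x => (Real.hasDerivAt_sin (s * x)).comp x (lin s x)) (by fun_prop)
        (fun x => Real.abs_sin_le_one _) (fun x => by
          rw [abs_mul]; exact mul_le_of_le_one_left (abs_nonneg _) (Real.abs_cos_le_one _))
      rw [integral_mul_const] at h1
      simp only [mul_neg, integral_neg]
      rw [← abs_neg]
      convert h1 using 2
      ring
  · have := ode (a := fun t => ∫ M, Real.sin (t * (cj C M * A).trace) ∂μ)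
      (fun t => hasDerivAt_integral_trig hμ hF (u := Real.sin) (u' := fun x => Real.cos x)
        Real.hasDerivAt_sin (by fun_prop) (fun x => Real.abs_cos_le_one x) t)
      (v := nF A ^ 2 / n) (δ := 17 / Real.sqrt n) (by positivity) (by positivity) ?_ t
    · simpa using this
    · intro s
      have h1 := stein hn hμ C A hC ht ht2 hA tA (u := fun x => Real.cos (s * x))
        (u' := fun x => -Real.sin (s * x) * s) (T := |s|)
        (fun x => (Real.hasDerivAt_cos (s * x)).comp x (lin s x)) (by fun_prop)
        (fun x => Real.abs_cos_le_one _) (fun x => by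
          rw [abs_mul, abs_neg]
          exact mul_le_of_le_one_left (abs_nonneg _) (Real.abs_sin_le_one _))
      rw [integral_mul_const, integral_neg] at h1
      convert h1 using 2
      ring

lemma perm_orth {n : ℕ} (σ : Equiv.Perm (Fin n)) :
    σ.permMatrix ℝ * (σ.permMatrix ℝ)ᵀ = 1 := by
  rw [Matrix.transpose_permMatrix, ← Matrix.permMatrix_mul]; simp

lemma perm_trace_zero {n : ℕ} (σ : Equiv.Perm (Fin n)) (h : ∀ i, σ i ≠ i) :
    (σ.permMatrix ℝ).trace = 0 := by
  rw [Matrix.trace_permutation]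
  have : Function.fixedPoints σ = ∅ := by
    ext i; simpa [Function.mem_fixedPoints, Function.IsFixedPt] using h i
  simp [this]

lemma rot_val {n : ℕ} (i : Fin n) :
    ((finRotate n i : Fin n) : ℕ) = if (i : ℕ) + 1 = n then 0 else (i : ℕ) + 1 := by
  obtain _ | m := n
  · exact i.elim0
  · rw [coe_finRotate]
    simp [Fin.ext_iff]

lemma rot_ne {n : ℕ} (hn : 3 ≤ n) (i : Fin n) : finRotate n i ≠ i := by
  intro h
  have := congrArg Fin.val h
  rw [rot_val] at this
  split_ifs at this <;> omega

lemma rot2_ne {n : ℕ} (hn : 3 ≤ n) (i : Fin n) : (finRotate n * finRotate n) i ≠ i := by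
  intro h
  have := congrArg Fin.val h
  rw [Equiv.Perm.mul_apply, rot_val, rot_val] at this
  split_ifs at this <;> omega

/-- traceless part -/
noncomputable def tl {n : ℕ} (A : Mat n) : Mat n := A - (A.trace / n) • (1 : Mat n)

lemma tl_trace {n : ℕ} (hn : 3 ≤ n) (A : Mat n) : (tl A).trace = 0 := by
  have : (n : ℝ) ≠ 0 := by positivity
  simp [tl, Matrix.trace_sub, Matrix.trace_smul]
  field_simp
  ring

lemma tl_nF {n : ℕ} (hn : 3 ≤ n) (A : Mat n) (hA : (A * Aᵀ).trace = n) :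
    nF (tl A) ^ 2 = n - A.trace ^ 2 / n := by
  have : (n : ℝ) ≠ 0 := by positivity
  rw [nF_sq, tl]
  simp only [Matrix.transpose_sub, Matrix.transpose_smul, Matrix.transpose_one, Matrix.sub_mul,
    Matrix.mul_sub, Matrix.smul_mul, Matrix.mul_smul, Matrix.one_mul, Matrix.mul_one,
    Matrix.trace_sub, Matrix.trace_smul, Matrix.trace_one, Matrix.trace_transpose, hA,
    smul_eq_mul, Fintype.card_fin]
  field_simp
  ring

lemma tl_stat {n : ℕ} (A C M : Mat n) (hM : M * Mᵀ = 1) (ht : C.trace = 0) :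
    (A * M * C * Mᵀ).trace = (cj C M * tl A).trace := by
  have h1 : (A * M * C * Mᵀ).trace = (cj C M * A).trace := by
    rw [Matrix.trace_mul_comm (cj C M)]; simp [cj, Matrix.mul_assoc]
  rw [h1, tl, Matrix.mul_sub, Matrix.trace_sub, Matrix.mul_smul, Matrix.trace_smul,
    Matrix.mul_one, cj_trace hM, ht]
  simp

lemma v_tendsto (A : ∀ n : ℕ, Matrix (Fin n) (Fin n) ℝ)
    (hA : ∀ n, Matrix.trace (A n * (A n)ᵀ) = (n : ℝ)) (c : ℝ)
    (hc : Filter.Tendsto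
      (fun n => (∑ i, ∑ j ∈ Finset.univ.erase i, A n i i * A n j j) / (n : ℝ) ^ 2)
      Filter.atTop (nhds c)) :
    Filter.Tendsto (fun n => nF (tl (A n)) ^ 2 / n) Filter.atTop (nhds (1 - c)) := by
  have h1 : ∀ n, ∑ i, ∑ j ∈ Finset.univ.erase i, A n i i * A n j j
      = (A n).trace ^ 2 - ∑ i, A n i i ^ 2 := by
    intro n
    have : ∀ i, ∑ j ∈ Finset.univ.erase i, A n i i * A n j j
        = A n i i * (A n).trace - A n i i ^ 2 := by
      intro i
      rw [← Finset.mul_sum, Finset.sum_erase_eq_sub (Finset.mem_univ i)]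
      simp only [Matrix.trace, Matrix.diag]; ring
    simp only [this, Finset.sum_sub_distrib, ← Finset.sum_mul]
    simp only [Matrix.trace, Matrix.diag]; ring
  have h2 : ∀ n, ∑ i, A n i i ^ 2 ≤ n := by
    intro n
    rw [← hA n, trace_mul_transpose_eq]
    refine Finset.sum_le_sum fun i _ => ?_
    rw [pow_two]
    exact Finset.single_le_sum (f := fun j => A n i j * A n i j)
      (fun j _ => mul_self_nonneg _) (Finset.mem_univ i)
  have h3 : Filter.Tendsto (fun n : ℕ => (∑ i, A n i i ^ 2) / (n : ℝ) ^ 2) Filter.atTop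
      (nhds 0) := by
    refine squeeze_zero (fun n => by positivity) (fun n => ?_)
      (tendsto_inv_atTop_nhds_zero_nat (𝕜 := ℝ))
    rcases Nat.eq_zero_or_pos n with rfl | hn
    · simp
    · have : (0:ℝ) < n := by exact_mod_cast hn
      rw [div_le_iff₀ (by positivity)]
      refine (h2 n).trans (le_of_eq ?_)
      field_simp
  have h4 := (hc.add h3).const_sub 1
  rw [add_zero] at h4
  refine h4.congr' ?_
  filter_upwards [Filter.eventually_ge_atTop 3] with n hn
  have : (n : ℝ) ≠ 0 := by positivity
  rw [tl_nF hn _ (hA n), h1]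
  field_simp
  ring

lemma charFun_map {n : ℕ} {μ : Measure (Mat n)} (hμ : IsHaarOrthogonal n μ) {F G : Mat n → ℝ}
    (hF : Continuous F) (hG : Continuous G) (h : ∀ M : Mat n, M * Mᵀ = 1 → F M = G M) (t : ℝ) :
    charFun (μ.map F) t = ((∫ M, Real.cos (t * G M) ∂μ : ℝ) : ℂ)
      + ((∫ M, Real.sin (t * G M) ∂μ : ℝ) : ℂ) * Complex.I := by
  rw [charFun_apply_real, integral_map hF.measurable.aemeasurable (by fun_prop),
    ← integral_complex_ofReal, ← integral_complex_ofReal, ← integral_mul_const, ← integral_add]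
  · refine integral_congr_ae ?_
    filter_upwards [hμ.ae_orth] with M hM
    rw [h M hM, Complex.exp_mul_I, ← Complex.ofReal_mul]
    simp
  · have hi : Integrable (fun M => Real.cos (t * G M)) μ := integrable_cont hμ (by fun_prop)
    exact hi.ofReal
  · have hi : Integrable (fun M => Real.sin (t * G M)) μ := integrable_cont hμ (by fun_prop)
    exact (hi.ofReal (𝕜 := ℂ)).mul_const _

end HaarCLT


open HaarCLT

/-- if `Tr(A_n A_nᵀ) = n` and `∑_{i≠j} A_{ii}A_{jj}/n² → c` with
`0 ≤ c ≤ 1`, then `Tr(A_n M C_n Mᵀ)` converges in distribution to `N(0, 1 − c)`,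
where `C_n` is the permutation matrix of the `n`-cycle `(1,2,...,n)`. -/
theorem stmt15 (A : ∀ n : ℕ, Matrix (Fin n) (Fin n) ℝ)
    (hA : ∀ n, Matrix.trace (A n * (A n)ᵀ) = (n : ℝ))
    (c : ℝ) (hc0 : 0 ≤ c) (hc1 : c ≤ 1)
    (hc : Filter.Tendsto
      (fun n => (∑ i, ∑ j ∈ Finset.univ.erase i, A n i i * A n j j) / (n : ℝ) ^ 2)
      Filter.atTop (nhds c))
    (μ : ∀ n : ℕ, Measure (Matrix (Fin n) (Fin n) ℝ))
    (hμ : ∀ n, IsHaarOrthogonal n (μ n)) :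
    ∀ g : ℝ →ᵇ ℝ,
      Filter.Tendsto
        (fun n => ∫ M, g (Matrix.trace (A n * M * (finRotate n).permMatrix ℝ * Mᵀ)) ∂(μ n))
        Filter.atTop (nhds (∫ x, g x ∂gaussianReal 0 (Real.toNNReal (1 - c)))) := by
  have hp := fun n => (hμ n).isProb
  have hFc : ∀ n, Continuous fun M : Mat n =>
      Matrix.trace (A n * M * (finRotate n).permMatrix ℝ * Mᵀ) := fun n => by fun_prop
  let ν : ℕ → ProbabilityMeasure ℝ := fun n =>
    ⟨(μ n).map (fun M : Mat n => Matrix.trace (A n * M * (finRotate n).permMatrix ℝ * Mᵀ)),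
      Measure.isProbabilityMeasure_map (hFc n).measurable.aemeasurable⟩
  let ν0 : ProbabilityMeasure ℝ := ⟨gaussianReal 0 (Real.toNNReal (1 - c)), inferInstance⟩
  have hv := v_tendsto A hA c hc
  have main : Filter.Tendsto ν Filter.atTop (nhds ν0) := by
    refine ProbabilityMeasure.tendsto_iff_tendsto_charFun.2 fun t => ?_
    have hδ : Filter.Tendsto (fun n : ℕ => 17 / Real.sqrt n * (1 + |t|) * |t|) Filter.atTop
        (nhds 0) := by
      have : Filter.Tendsto (fun n : ℕ => 17 / Real.sqrt n) Filter.atTop (nhds 0) :=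
        Filter.Tendsto.const_div_atTop
          (Real.tendsto_sqrt_atTop.comp tendsto_natCast_atTop_atTop) _
      simpa using (this.mul_const (1 + |t|)).mul_const |t|
    have hb : ∀ᶠ n in Filter.atTop,
        |∫ M, Real.cos (t * (cj ((finRotate n).permMatrix ℝ) M * tl (A n)).trace) ∂(μ n)
          - Real.exp (-(nF (tl (A n)) ^ 2 / n * t ^ 2 / 2))|
          ≤ 17 / Real.sqrt n * (1 + |t|) * |t| ∧
        |∫ M, Real.sin (t * (cj ((finRotate n).permMatrix ℝ) M * tl (A n)).trace) ∂(μ n)|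
          ≤ 17 / Real.sqrt n * (1 + |t|) * |t| := by
      filter_upwards [Filter.eventually_ge_atTop 3] with n hn
      refine char_bounds hn (hμ n) _ _ (perm_orth _) (perm_trace_zero _ (rot_ne hn)) ?_ ?_
        (tl_trace hn _) t
      · rw [← Matrix.permMatrix_mul]
        exact perm_trace_zero _ (rot2_ne hn)
      · rw [tl_nF hn _ (hA n)]
        have : 0 ≤ (A n).trace ^ 2 / n := by positivity
        linarith
    have hexp : Filter.Tendsto (fun n : ℕ => Real.exp (-(nF (tl (A n)) ^ 2 / n * t ^ 2 / 2)))
        Filter.atTop (nhds (Real.exp (-((1 - c) * t ^ 2 / 2)))) :=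
      (Real.continuous_exp.tendsto _).comp ((hv.mul_const _).div_const _).neg
    have hcos := (squeeze_zero_norm' (hb.mono fun n h => h.1) hδ).add hexp
    have hsin := squeeze_zero_norm' (f := fun n : ℕ =>
      ∫ M, Real.sin (t * (cj ((finRotate n).permMatrix ℝ) M * tl (A n)).trace) ∂(μ n))
      (hb.mono fun n h => h.2) hδ
    simp only [sub_add_cancel, zero_add] at hcos
    have hlim := ((Complex.continuous_ofReal.tendsto _).comp hcos).add
      (((Complex.continuous_ofReal.tendsto _).comp hsin).mul_const Complex.I)
    have e0 : charFun (ν0 : Measure ℝ) t = ((Real.exp (-((1 - c) * t ^ 2 / 2)) : ℝ) : ℂ)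
        + ((0:ℝ) : ℂ) * Complex.I := by
      change charFun (gaussianReal 0 (Real.toNNReal (1 - c))) t = _
      rw [charFun_gaussianReal, Real.coe_toNNReal _ (by linarith)]
      push_cast
      simp
    rw [e0]
    refine hlim.congr' ?_
    filter_upwards [Filter.eventually_ge_atTop 3] with n hn
    have hcj := continuous_cj ((finRotate n).permMatrix ℝ)
    exact (charFun_map (hμ n) (hFc n) (by fun_prop)
      (fun M hM => tl_stat (A n) _ M hM (perm_trace_zero _ (rot_ne hn))) t).symm
  intro g
  have h1 := (ProbabilityMeasure.tendsto_iff_forall_integral_tendsto.1 main) g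
  refine h1.congr fun n => ?_
  change ∫ x, g x ∂((μ n).map (fun M : Mat n =>
    Matrix.trace (A n * M * (finRotate n).permMatrix ℝ * Mᵀ))) = _
  rw [integral_map (hFc n).measurable.aemeasurable g.continuous.measurable.aestronglyMeasurable]
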